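/- Let (T_n) be a sequence of Liverani–Saussol–Vaienti maps with parameters γ_n ∈ (0,1) satisfying sup_n γ_n = γ* < 1, and let γ ∈ (0,1). There exists a constant κ_0 ∈ (0,1) such that the following holds: if for some a > 0, some κ with 0 < κ ≤ κ_0, and some N ∈ ℕ one has #{1 ≤ k ≤ n : γ_k ≤ γ}/n ∈ [a(1-κ), a(1+κ)] for all n ≥ N, then for any two probability measures μ and μ' on [0,1] with Hölder continuous densities (with respect to Lebesgue measure), the total variation distance satisfies |(T_{1,n})_*(μ - μ')| = O(n^{-1/γ}) as n → ∞. -/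

import Mathlib

open MeasureTheory Set Filter
open scoped NNReal ENNReal

noncomputable section

/-- `seqComp T k n = T (k+n-1) ∘ ⋯ ∘ T (k+1) ∘ T k`, i.e. the composition `T_{k,k+n-1}`. -/
def seqComp {α : Type*} (T : ℕ → α → α) (k : ℕ) : ℕ → α → α
  | 0 => id
  | n + 1 => fun x => T (k + n) (seqComp T k n x)

/-- The Liverani–Saussol–Vaienti map with parameter `γ`. -/
def lsv (γ : ℝ) (x : ℝ) : ℝ :=
  if x < 1 / 2 then x * (1 + 2 ^ γ * x ^ γ) else 2 * (x - 1 / 2)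

/-- Total variation distance between two (finite) measures. -/
def tvDist {α : Type*} [MeasurableSpace α] (μ ν : Measure α) : ℝ :=
  ⨆ s : { s : Set α // MeasurableSet s }, |(μ s.1).toReal - (ν s.1).toReal|

/-- `μ` is a measure on `s ⊆ ℝ` with a Hölder continuous density w.r.t. Lebesgue measure. -/
def HolderDensityOn (s : Set ℝ) (μ : Measure ℝ) : Prop :=
  ∃ f : ℝ → ℝ, (∀ x, 0 ≤ f x) ∧
    (∃ C r : ℝ≥0, 0 < r ∧ r ≤ 1 ∧ HolderOnWith C r f s) ∧
    μ = (volume.restrict s).withDensity fun x => ENNReal.ofReal (f x)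

/-- Membership in the cone `C_*(β)` (with constant `aβ`). -/
def memConeStar (β aβ : ℝ) (f : ℝ → ℝ) : Prop :=
  ContinuousOn f (Ioc 0 1) ∧ IntegrableOn f (Ioc 0 1) ∧
  (∀ x ∈ Ioc (0:ℝ) 1, 0 ≤ f x) ∧ AntitoneOn f (Ioc 0 1) ∧
  MonotoneOn (fun x => x ^ (β + 1) * f x) (Ioc 0 1) ∧
  ∀ x ∈ Ioc (0:ℝ) 1, f x ≤ aβ * x ^ (-β) * ∫ t in Ioc (0:ℝ) 1, f t

/-- The left branch of the Liverani–Saussol–Vaienti map. -/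
def lsvLeft (γ y : ℝ) : ℝ := y * (1 + 2 ^ γ * y ^ γ)

/-- The derivative of the left branch of the Liverani–Saussol–Vaienti map. -/
def lsvLeftDeriv (γ y : ℝ) : ℝ := 1 + (1 + γ) * (2 ^ γ * y ^ γ)

/-- The inverse of the left branch, extended monotonically to `ℝ`. -/
def lsvLeftInv (γ x : ℝ) : ℝ := sSup {y ∈ Icc (0 : ℝ) (1 / 2) | lsvLeft γ y ≤ x}

theorem lsvLeft_strictMonoOn {γ : ℝ} (hγ : 0 < γ) : StrictMonoOn (lsvLeft γ) (Ici 0) := by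
  intro x hx y hy hxy
  have hx : 0 ≤ x := hx
  have h1 : x ^ γ < y ^ γ := Real.rpow_lt_rpow hx hxy hγ
  have h2 : (0 : ℝ) < 2 ^ γ := by positivity
  have h3 : 0 ≤ x ^ γ := by positivity
  unfold lsvLeft
  have h4 : 2 ^ γ * x ^ γ < 2 ^ γ * y ^ γ := by gcongr
  have h5 : 0 ≤ 2 ^ γ * x ^ γ := by positivity
  nlinarith

theorem lsvLeft_zero (γ : ℝ) : lsvLeft γ 0 = 0 := by simp [lsvLeft]

theorem lsvLeft_half (γ : ℝ) : lsvLeft γ (1 / 2) = 1 := by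
  unfold lsvLeft
  rw [← Real.mul_rpow (by norm_num) (by norm_num)]
  norm_num

theorem continuous_lsvLeft {γ : ℝ} (hγ : 0 < γ) : Continuous (lsvLeft γ) := by
  have : Continuous fun y : ℝ => y ^ γ := Real.continuous_rpow_const hγ.le
  unfold lsvLeft
  fun_prop

theorem hasDerivAt_lsvLeft (γ : ℝ) {y : ℝ} (hy : 0 < y) :
    HasDerivAt (lsvLeft γ) (lsvLeftDeriv γ y) y := by
  have h1 : HasDerivAt (fun y : ℝ => y ^ γ) (γ * y ^ (γ - 1)) y :=
    Real.hasDerivAt_rpow_const (Or.inl hy.ne')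
  have h2 := (hasDerivAt_id y).mul ((h1.const_mul (2 ^ γ)).const_add 1)
  refine HasDerivAt.congr_deriv (f := lsvLeft γ) h2 ?_
  rw [lsvLeftDeriv, id, Real.rpow_sub_one hy.ne']
  field_simp
  ring

theorem one_le_lsvLeftDeriv {γ y : ℝ} (hγ : 0 < γ) (hy : 0 ≤ y) : 1 ≤ lsvLeftDeriv γ y := by
  have : 0 ≤ (1 + γ) * (2 ^ γ * y ^ γ) := by positivity
  unfold lsvLeftDeriv
  linarith

theorem monotone_lsvLeftInv (γ : ℝ) : Monotone (lsvLeftInv γ) := by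
  intro x x' hx
  rcases Set.eq_empty_or_nonempty {y ∈ Icc (0 : ℝ) (1 / 2) | lsvLeft γ y ≤ x} with h | h
  · unfold lsvLeftInv
    rw [h, Real.sSup_empty]
    exact Real.sSup_nonneg fun y hy => hy.1.1
  · exact csSup_le_csSup ⟨1 / 2, fun y hy => hy.1.2⟩ h fun y hy => ⟨hy.1, hy.2.trans hx⟩

theorem lsvLeftInv_lsvLeft {γ y : ℝ} (hγ : 0 < γ) (hy : y ∈ Icc (0 : ℝ) (1 / 2)) :
    lsvLeftInv γ (lsvLeft γ y) = y := by
  have : {z ∈ Icc (0 : ℝ) (1 / 2) | lsvLeft γ z ≤ lsvLeft γ y} = Icc 0 y := by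
    ext z
    constructor
    · rintro ⟨hz, h⟩
      exact ⟨hz.1, ((lsvLeft_strictMonoOn hγ).le_iff_le hz.1 hy.1).1 h⟩
    · rintro hz
      exact ⟨⟨hz.1, hz.2.trans hy.2⟩,
        ((lsvLeft_strictMonoOn hγ).le_iff_le (mem_Ici.2 hz.1) hy.1).2 hz.2⟩
  rw [lsvLeftInv, this, csSup_Icc hy.1]

theorem exists_lsvLeft_eq {γ x : ℝ} (hγ : 0 < γ) (hx : x ∈ Ioc (0 : ℝ) 1) :
    ∃ y ∈ Ioc (0 : ℝ) (1 / 2), lsvLeft γ y = x := by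
  have h := intermediate_value_Icc (show (0 : ℝ) ≤ 1 / 2 by norm_num)
    (continuous_lsvLeft hγ).continuousOn
  rw [lsvLeft_zero, lsvLeft_half] at h
  obtain ⟨y, hy, rfl⟩ := h ⟨hx.1.le, hx.2⟩
  refine ⟨y, ⟨hy.1.lt_of_ne ?_, hy.2⟩, rfl⟩
  rintro rfl
  exact hx.1.ne' (lsvLeft_zero γ)

theorem lsvLeftInv_mem {γ x : ℝ} (hγ : 0 < γ) (hx : x ∈ Ioc (0 : ℝ) 1) :
    lsvLeftInv γ x ∈ Ioc (0 : ℝ) (1 / 2) := by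
  obtain ⟨y, hy, rfl⟩ := exists_lsvLeft_eq hγ hx
  rwa [lsvLeftInv_lsvLeft hγ ⟨hy.1.le, hy.2⟩]

theorem lsvLeft_lsvLeftInv {γ x : ℝ} (hγ : 0 < γ) (hx : x ∈ Ioc (0 : ℝ) 1) :
    lsvLeft γ (lsvLeftInv γ x) = x := by
  obtain ⟨y, hy, rfl⟩ := exists_lsvLeft_eq hγ hx
  rw [lsvLeftInv_lsvLeft hγ ⟨hy.1.le, hy.2⟩]

theorem lsvLeftInv_le {γ x : ℝ} (hγ : 0 < γ) (hx : x ∈ Ioc (0 : ℝ) 1) :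
    lsvLeftInv γ x ≤ x := by
  have h := lsvLeft_lsvLeftInv hγ hx
  have h0 := (lsvLeftInv_mem hγ hx).1
  have : 0 ≤ lsvLeftInv γ x * (2 ^ γ * lsvLeftInv γ x ^ γ) := by positivity
  unfold lsvLeft at h
  linarith

theorem lsvLeft_image_Ioc {γ x : ℝ} (hγ : 0 < γ) (hx : x ∈ Ioc (0 : ℝ) 1) :
    lsvLeft γ '' Ioc 0 (lsvLeftInv γ x) = Ioc 0 x := by
  ext t
  constructor
  · rintro ⟨y, hy, rfl⟩
    have := lsvLeft_strictMonoOn hγ (mem_Ici.2 le_rfl) (mem_Ici.2 hy.1.le) hy.1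
    rw [lsvLeft_zero] at this
    refine ⟨this, ?_⟩
    rw [← lsvLeft_lsvLeftInv hγ hx]
    exact (lsvLeft_strictMonoOn hγ).monotoneOn hy.1.le (lsvLeftInv_mem hγ hx).1.le hy.2
  · intro ht
    have ht' : t ∈ Ioc (0 : ℝ) 1 := ⟨ht.1, ht.2.trans hx.2⟩
    exact ⟨lsvLeftInv γ t, ⟨(lsvLeftInv_mem hγ ht').1, monotone_lsvLeftInv γ ht.2⟩,
      lsvLeft_lsvLeftInv hγ ht'⟩

theorem lsv_eq_of_lt {γ x : ℝ} (hx : x < 1 / 2) : lsv γ x = lsvLeft γ x := by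
  simp only [lsv, lsvLeft, if_pos hx]

theorem lsv_eq_of_ge {γ x : ℝ} (hx : 1 / 2 ≤ x) : lsv γ x = 2 * x - 1 := by
  simp only [lsv, if_neg hx.not_gt]
  ring

theorem measurable_lsv (γ : ℝ) : Measurable (lsv γ) := by
  unfold lsv
  refine Measurable.ite measurableSet_Iio ?_ ?_ <;> fun_prop

theorem measurable_seqComp {T : ℕ → ℝ → ℝ} (hT : ∀ i, Measurable (T i)) (k n : ℕ) :
    Measurable (seqComp T k n) := by
  induction n with
  | zero => exact measurable_id
  | succ n ih => exact (hT _).comp ih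

/-- The part of the transfer operator coming from the left branch. -/
def lsvTransferLeft (γ : ℝ) (f : ℝ → ℝ) (x : ℝ) : ℝ :=
  f (lsvLeftInv γ x) / lsvLeftDeriv γ (lsvLeftInv γ x)

/-- The part of the transfer operator coming from the right branch. -/
def lsvTransferRight (f : ℝ → ℝ) (x : ℝ) : ℝ := f ((x + 1) / 2) / 2

/-- The transfer operator of `lsv γ` with respect to Lebesgue measure on `(0, 1]`. -/
def lsvTransfer (γ : ℝ) (f : ℝ → ℝ) (x : ℝ) : ℝ :=
  lsvTransferLeft γ f x + lsvTransferRight f x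

section Left

variable {γ : ℝ} {s : Set ℝ}

theorem lsvTransferLeft_comp (hγ : 0 < γ) (f : ℝ → ℝ) {y : ℝ} (hy : y ∈ Ioc (0 : ℝ) (1 / 2)) :
    |lsvLeftDeriv γ y| • lsvTransferLeft γ f (lsvLeft γ y) = f y := by
  have h1 := one_le_lsvLeftDeriv hγ hy.1.le
  have h0 : lsvLeftDeriv γ y ≠ 0 := by positivity
  rw [lsvTransferLeft, lsvLeftInv_lsvLeft hγ ⟨hy.1.le, hy.2⟩, abs_of_pos (by positivity),
    smul_eq_mul, mul_div_cancel₀ _ h0]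

theorem lsvLeft_injOn (hγ : 0 < γ) (hs : s ⊆ Ioc 0 (1 / 2)) : InjOn (lsvLeft γ) s :=
  (lsvLeft_strictMonoOn hγ).injOn.mono fun _ hy => (hs hy).1.le

theorem integrableOn_lsvTransferLeft (hγ : 0 < γ) (hs : s ⊆ Ioc 0 (1 / 2)) (hm : MeasurableSet s)
    {f : ℝ → ℝ} (hf : IntegrableOn f s) :
    IntegrableOn (lsvTransferLeft γ f) (lsvLeft γ '' s) := by
  rw [integrableOn_image_iff_integrableOn_abs_deriv_smul hm
    (fun y hy => (hasDerivAt_lsvLeft γ (hs hy).1).hasDerivWithinAt) (lsvLeft_injOn hγ hs)]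
  exact hf.congr_fun (fun y hy => (lsvTransferLeft_comp hγ f (hs hy)).symm) hm

theorem setIntegral_lsvTransferLeft (hγ : 0 < γ) (hs : s ⊆ Ioc 0 (1 / 2)) (hm : MeasurableSet s)
    (f : ℝ → ℝ) : ∫ x in lsvLeft γ '' s, lsvTransferLeft γ f x = ∫ y in s, f y := by
  rw [integral_image_eq_integral_abs_deriv_smul hm
    (fun y hy => (hasDerivAt_lsvLeft γ (hs hy).1).hasDerivWithinAt) (lsvLeft_injOn hγ hs)]
  exact setIntegral_congr_fun hm fun y hy => lsvTransferLeft_comp hγ f (hs hy)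

end Left

section Right

variable {s : Set ℝ}

theorem lsvTransferRight_comp (f : ℝ → ℝ) (y : ℝ) :
    |(2 : ℝ)| • lsvTransferRight f (2 * y - 1) = f y := by
  rw [lsvTransferRight, abs_two, smul_eq_mul, mul_div_cancel₀ _ two_ne_zero]
  congr 1
  ring

theorem hasDerivAt_two_mul_sub_one (y : ℝ) : HasDerivAt (fun y : ℝ => 2 * y - 1) 2 y := by
  simpa using ((hasDerivAt_id y).const_mul 2).sub_const 1

theorem two_mul_sub_one_injOn : InjOn (fun y : ℝ => 2 * y - 1) s := by
  intro x _ y _ h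
  have h : 2 * x - 1 = 2 * y - 1 := h
  linarith

theorem integrableOn_lsvTransferRight (hm : MeasurableSet s) {f : ℝ → ℝ}
    (hf : IntegrableOn f s) :
    IntegrableOn (lsvTransferRight f) ((fun y => 2 * y - 1) '' s) := by
  rw [integrableOn_image_iff_integrableOn_abs_deriv_smul hm
    (fun y _ => (hasDerivAt_two_mul_sub_one y).hasDerivWithinAt) two_mul_sub_one_injOn]
  exact hf.congr_fun (fun y _ => (lsvTransferRight_comp f y).symm) hm

theorem setIntegral_lsvTransferRight (hm : MeasurableSet s) (f : ℝ → ℝ) :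
    ∫ x in (fun y => 2 * y - 1) '' s, lsvTransferRight f x = ∫ y in s, f y := by
  rw [integral_image_eq_integral_abs_deriv_smul hm
    (fun y _ => (hasDerivAt_two_mul_sub_one y).hasDerivWithinAt) two_mul_sub_one_injOn]
  exact setIntegral_congr_fun hm fun y _ => lsvTransferRight_comp f y

end Right

theorem lsvLeft_image_inter {γ : ℝ} (hγ : 0 < γ) (S : Set ℝ) :
    lsvLeft γ '' (Ioc 0 (1 / 2) ∩ lsvLeft γ ⁻¹' S) = Ioc 0 1 ∩ S := by
  have h := lsvLeft_image_Ioc hγ (right_mem_Ioc.2 (zero_lt_one' ℝ))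
  have h' : lsvLeftInv γ 1 = 1 / 2 := by
    simpa only [lsvLeft_half] using lsvLeftInv_lsvLeft hγ (right_mem_Icc.2 one_half_pos.le)
  rw [image_inter_preimage, ← h, h']

theorem right_image_inter (S : Set ℝ) :
    (fun y : ℝ => 2 * y - 1) '' (Ioc (1 / 2) 1 ∩ (fun y : ℝ => 2 * y - 1) ⁻¹' S) =
      Ioc 0 1 ∩ S := by
  rw [image_inter_preimage]
  congr 1
  ext x
  constructor
  · rintro ⟨y, hy, rfl⟩
    constructor <;> dsimp only <;> linarith [hy.1, hy.2]
  · intro hx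
    exact ⟨(x + 1) / 2, ⟨by linarith [hx.1], by linarith [hx.2]⟩, by ring⟩

section Transfer

variable {γ : ℝ} {f : ℝ → ℝ}

theorem integrableOn_lsvTransferLeft_Ioc (hγ : 0 < γ) (hf : IntegrableOn f (Ioc 0 1)) :
    IntegrableOn (lsvTransferLeft γ f) (Ioc 0 1) := by
  have h := integrableOn_lsvTransferLeft hγ inter_subset_left
    (measurableSet_Ioc.inter ((continuous_lsvLeft hγ).measurable MeasurableSet.univ))
    (hf.mono_set (inter_subset_left.trans (Ioc_subset_Ioc_right (by norm_num))))
  rwa [lsvLeft_image_inter hγ, inter_univ] at h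

theorem integrableOn_lsvTransferRight_Ioc (hf : IntegrableOn f (Ioc 0 1)) :
    IntegrableOn (lsvTransferRight f) (Ioc 0 1) := by
  have h := integrableOn_lsvTransferRight (s := Ioc (1 / 2) 1) measurableSet_Ioc
    (hf.mono_set (Ioc_subset_Ioc_left (by norm_num)))
  have h' := right_image_inter univ
  rw [preimage_univ, inter_univ, inter_univ] at h'
  rwa [h'] at h

theorem integrableOn_lsvTransfer (hγ : 0 < γ) (hf : IntegrableOn f (Ioc 0 1)) :
    IntegrableOn (lsvTransfer γ f) (Ioc 0 1) :=
  (integrableOn_lsvTransferLeft_Ioc hγ hf).add (integrableOn_lsvTransferRight_Ioc hf)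

theorem setIntegral_lsvTransfer (hγ : 0 < γ) (hf : IntegrableOn f (Ioc 0 1)) {S : Set ℝ}
    (hS : MeasurableSet S) :
    ∫ x in Ioc 0 1 ∩ S, lsvTransfer γ f x = ∫ x in Ioc 0 1 ∩ lsv γ ⁻¹' S, f x := by
  set s₁ := Ioc (0 : ℝ) (1 / 2) ∩ lsvLeft γ ⁻¹' S
  set s₂ := Ioc (1 / 2 : ℝ) 1 ∩ (fun y : ℝ => 2 * y - 1) ⁻¹' S
  have hm₁ : MeasurableSet s₁ := measurableSet_Ioc.inter ((continuous_lsvLeft hγ).measurable hS)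
  have hm₂ : MeasurableSet s₂ := measurableSet_Ioc.inter
    ((by fun_prop : Measurable fun y : ℝ => 2 * y - 1) hS)
  have hd : Disjoint s₁ s₂ := by
    rw [Set.disjoint_left]
    intro x h₁ h₂
    exact absurd h₁.1.2 (not_le.2 h₂.1.1)
  have hae : (Ioc 0 1 ∩ lsv γ ⁻¹' S : Set ℝ) =ᵐ[volume] (s₁ ∪ s₂ : Set ℝ) := by
    filter_upwards [compl_mem_ae_iff.2 (measure_singleton (μ := volume) (1 / 2 : ℝ))] with x hx
    have hx : x ≠ 1 / 2 := hx
    refine propext ?_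
    change (x ∈ Ioc (0 : ℝ) 1 ∧ lsv γ x ∈ S) ↔ (x ∈ Ioc (0 : ℝ) (1 / 2) ∧ lsvLeft γ x ∈ S) ∨
      (x ∈ Ioc (1 / 2 : ℝ) 1 ∧ 2 * x - 1 ∈ S)
    rcases lt_or_gt_of_ne hx with h | h
    · rw [lsv_eq_of_lt h]
      constructor
      · rintro ⟨h₁, h₂⟩
        exact Or.inl ⟨⟨h₁.1, h.le⟩, h₂⟩
      · rintro (⟨h₁, h₂⟩ | ⟨h₁, h₂⟩)
        · exact ⟨⟨h₁.1, h₁.2.trans (by norm_num)⟩, h₂⟩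
        · exact absurd h₁.1 h.not_gt
    · rw [lsv_eq_of_ge h.le]
      constructor
      · rintro ⟨h₁, h₂⟩
        exact Or.inr ⟨⟨h, h₁.2⟩, h₂⟩
      · rintro (⟨h₁, h₂⟩ | ⟨h₁, h₂⟩)
        · exact absurd h₁.2 h.not_ge
        · exact ⟨⟨lt_trans (by norm_num) h₁.1, h₁.2⟩, h₂⟩
  have hi₁ : IntegrableOn f s₁ :=
    hf.mono_set (inter_subset_left.trans (Ioc_subset_Ioc_right (by norm_num)))
  have hi₂ : IntegrableOn f s₂ :=
    hf.mono_set (inter_subset_left.trans (Ioc_subset_Ioc_left (by norm_num)))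
  rw [setIntegral_congr_set hae, setIntegral_union hd hm₂ hi₁ hi₂,
    ← setIntegral_lsvTransferLeft hγ inter_subset_left hm₁, ← setIntegral_lsvTransferRight hm₂,
    lsvLeft_image_inter hγ, right_image_inter]
  exact integral_add ((integrableOn_lsvTransferLeft_Ioc hγ hf).mono_set inter_subset_left)
    ((integrableOn_lsvTransferRight_Ioc hf).mono_set inter_subset_left)

theorem integral_lsvTransfer (hγ : 0 < γ) (hf : IntegrableOn f (Ioc 0 1)) :
    ∫ x in Ioc 0 1, lsvTransfer γ f x = ∫ x in Ioc 0 1, f x := by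
  have h := setIntegral_lsvTransfer hγ hf MeasurableSet.univ
  rwa [preimage_univ, inter_univ] at h

theorem setIntegral_lsvTransferLeft_Ioc (hγ : 0 < γ) {x : ℝ} (hx : x ∈ Ioc (0 : ℝ) 1) :
    ∫ t in Ioc 0 x, lsvTransferLeft γ f t = ∫ t in Ioc 0 (lsvLeftInv γ x), f t := by
  rw [← lsvLeft_image_Ioc hγ hx]
  exact setIntegral_lsvTransferLeft hγ (Ioc_subset_Ioc_right (lsvLeftInv_mem hγ hx).2)
    measurableSet_Ioc f

end Transfer

theorem setIntegral_seqComp {γs : ℕ → ℝ} (hγ : ∀ n, 1 ≤ n → 0 < γs n) {f : ℕ → ℝ → ℝ}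
    (hf : ∀ n, IntegrableOn (f n) (Ioc 0 1))
    (hstep : ∀ n, ∀ x ∈ Ioc (0 : ℝ) 1, f (n + 1) x = lsvTransfer (γs (1 + n)) (f n) x)
    (n : ℕ) {S : Set ℝ} (hS : MeasurableSet S) :
    ∫ x in Ioc 0 1 ∩ seqComp (fun i => lsv (γs i)) 1 n ⁻¹' S, f 0 x =
      ∫ x in Ioc 0 1 ∩ S, f n x := by
  induction n generalizing S with
  | zero => rfl
  | succ n ih =>
    rw [setIntegral_congr_fun (measurableSet_Ioc.inter hS) fun x hx => hstep n x hx.1,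
      setIntegral_lsvTransfer (hγ _ (by omega)) (hf n) hS]
    exact ih (measurable_lsv _ hS)

/-- The modulus of continuity used for logarithms of densities in logarithmic coordinates. -/
def logModulus (D r R : ℝ) : ℝ := 2 * R + D * R ^ r

/-- Nonnegative functions on `(0, 1]` whose logarithm has modulus of continuity `ω` with respect
to the metric `|log x - log y|`. -/
def LogRegular (ω : ℝ → ℝ) (f : ℝ → ℝ) : Prop :=
  (∀ x ∈ Ioc (0 : ℝ) 1, 0 ≤ f x) ∧
  ∀ x ∈ Ioc (0 : ℝ) 1, ∀ y ∈ Ioc (0 : ℝ) 1, x ≤ y →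
    f x ≤ Real.exp (ω (Real.log (y / x))) * f y ∧ f y ≤ Real.exp (ω (Real.log (y / x))) * f x

theorem log_div_nonneg {x y : ℝ} (hx : 0 < x) (hxy : x ≤ y) : 0 ≤ Real.log (y / x) :=
  Real.log_nonneg ((one_le_div hx).2 hxy)

section Modulus

variable {D r : ℝ}

theorem logModulus_mono (hD : 0 ≤ D) (hr : 0 < r) {R R' : ℝ} (hR : 0 ≤ R) (h : R ≤ R') :
    logModulus D r R + 2 * (R' - R) ≤ logModulus D r R' := by
  have := mul_le_mul_of_nonneg_left (Real.rpow_le_rpow hR h hr.le) hD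
  unfold logModulus
  linarith

theorem logModulus_nonneg (hD : 0 ≤ D) {R : ℝ} (hR : 0 ≤ R) : 0 ≤ logModulus D r R := by
  unfold logModulus
  positivity

theorem logModulus_half_le (hr : r ≤ 1) {R : ℝ} (hR : 0 ≤ R) :
    logModulus D r (R / 2) ≤ (1 / 2) ^ r * logModulus D r R := by
  have h1 : (1 / 2 : ℝ) ^ (1 : ℝ) ≤ (1 / 2) ^ r :=
    Real.rpow_le_rpow_of_exponent_ge (by norm_num) (by norm_num) hr
  rw [Real.rpow_one] at h1
  unfold logModulus
  rw [div_eq_mul_one_div R 2, Real.mul_rpow hR (by norm_num)]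
  nlinarith

end Modulus

theorem lsv_left_distortion {γ x y : ℝ} (hγ : γ ∈ Ioo (0 : ℝ) 1) (hx : x ∈ Ioc (0 : ℝ) 1)
    (hy : y ∈ Ioc (0 : ℝ) 1) (hxy : x ≤ y) :
    let p := lsvLeftInv γ x
    let q := lsvLeftInv γ y
    p ≤ q ∧ Real.log (q / p) ≤ Real.log (y / x) ∧
      lsvLeftDeriv γ p ≤ lsvLeftDeriv γ q ∧
      lsvLeftDeriv γ q ≤
        Real.exp (2 * (Real.log (y / x) - Real.log (q / p))) * lsvLeftDeriv γ p := by
  intro p q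
  have hp : 0 < p := (lsvLeftInv_mem hγ.1 hx).1
  have hq : 0 < q := (lsvLeftInv_mem hγ.1 hy).1
  have hpq : p ≤ q := monotone_lsvLeftInv γ hxy
  have hTp : p * (1 + 2 ^ γ * p ^ γ) = x := lsvLeft_lsvLeftInv hγ.1 hx
  have hTq : q * (1 + 2 ^ γ * q ^ γ) = y := lsvLeft_lsvLeftInv hγ.1 hy
  have huv : 2 ^ γ * p ^ γ ≤ 2 ^ γ * q ^ γ := by
    have := Real.rpow_le_rpow hp.le hpq hγ.1.le
    gcongr
  have hu : 0 ≤ 2 ^ γ * p ^ γ := by positivity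
  unfold lsvLeftDeriv
  set u := 2 ^ γ * p ^ γ
  set v := 2 ^ γ * q ^ γ
  have hratio : (y / x) / (q / p) = (1 + v) / (1 + u) := by
    rw [← hTp, ← hTq]
    field_simp
  have hlog : Real.log (y / x) - Real.log (q / p) = Real.log ((1 + v) / (1 + u)) := by
    have hx0 := hx.1
    have hy0 := hy.1
    rw [← hratio, Real.log_div (div_pos hy0 hx0).ne' (div_pos hq hp).ne']
  have hge : 1 ≤ (1 + v) / (1 + u) := (one_le_div (by positivity)).2 (by linarith)
  refine ⟨hpq, ?_, ?_, ?_⟩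
  · have := Real.log_nonneg hge
    linarith
  · nlinarith [hγ.1]
  · have hv : 0 ≤ v := hu.trans huv
    rw [hlog, mul_comm 2, Real.exp_mul, Real.exp_log (by positivity), Real.rpow_two, div_pow,
      div_mul_eq_mul_div, le_div_iff₀ (by positivity)]
    have h1 : 0 ≤ (1 - γ) * (v - u) := mul_nonneg (by linarith [hγ.2]) (by linarith)
    have h2 : 0 ≤ (1 + γ) * u * v * (v - u) :=
      mul_nonneg (mul_nonneg (mul_nonneg (by linarith [hγ.1]) hu) hv) (by linarith)
    have h3 : 0 ≤ (v - u) * (v + u) := mul_nonneg (by linarith) (by linarith)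
    nlinarith

theorem LogRegular.lsvTransferLeft {γ D r : ℝ} {f : ℝ → ℝ} (hγ : γ ∈ Ioo (0 : ℝ) 1) (hD : 0 ≤ D)
    (hr : 0 < r) (hf : LogRegular (logModulus D r) f) :
    LogRegular (logModulus D r) (lsvTransferLeft γ f) := by
  have hmem : ∀ x ∈ Ioc (0 : ℝ) 1, lsvLeftInv γ x ∈ Ioc (0 : ℝ) 1 := fun x hx =>
    Ioc_subset_Ioc_right (by norm_num) (lsvLeftInv_mem hγ.1 hx)
  have hpos : ∀ x ∈ Ioc (0 : ℝ) 1, 0 < lsvLeftDeriv γ (lsvLeftInv γ x) := fun x hx =>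
    one_pos.trans_le (one_le_lsvLeftDeriv hγ.1 (hmem x hx).1.le)
  refine ⟨fun x hx => div_nonneg (hf.1 _ (hmem x hx)) (hpos x hx).le, fun x hx y hy hxy => ?_⟩
  obtain ⟨hpq, hlog, hD1, hD2⟩ := lsv_left_distortion hγ hx hy hxy
  obtain ⟨h1, h2⟩ := hf.2 _ (hmem x hx) _ (hmem y hy) hpq
  have hω := logModulus_mono hD hr (log_div_nonneg (hmem x hx).1 hpq) hlog
  have hfx := hf.1 _ (hmem x hx)
  have hfy := hf.1 _ (hmem y hy)
  have hpx := hpos x hx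
  have hpy := hpos y hy
  unfold _root_.lsvTransferLeft
  set p := lsvLeftInv γ x
  set q := lsvLeftInv γ y
  constructor
  · rw [div_le_iff₀ hpx]
    calc f p ≤ Real.exp (logModulus D r (Real.log (q / p))) * f q := h1
      _ = Real.exp (logModulus D r (Real.log (q / p))) * (f q / lsvLeftDeriv γ q) *
            lsvLeftDeriv γ q := by field_simp
      _ ≤ Real.exp (logModulus D r (Real.log (q / p))) * (f q / lsvLeftDeriv γ q) *
            (Real.exp (2 * (Real.log (y / x) - Real.log (q / p))) * lsvLeftDeriv γ p) := by
          gcongr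
      _ = Real.exp (logModulus D r (Real.log (q / p)) +
            2 * (Real.log (y / x) - Real.log (q / p))) * (f q / lsvLeftDeriv γ q) *
            lsvLeftDeriv γ p := by rw [Real.exp_add]; ring
      _ ≤ _ := by gcongr
  · calc f q / lsvLeftDeriv γ q ≤ f q / lsvLeftDeriv γ p := by gcongr
      _ ≤ Real.exp (logModulus D r (Real.log (q / p))) * f p / lsvLeftDeriv γ p := by gcongr
      _ ≤ Real.exp (logModulus D r (Real.log (y / x))) * f p / lsvLeftDeriv γ p := by
          gcongr
          linarith
      _ = _ := by ring

theorem LogRegular.lsvTransferRight {D r : ℝ} {f : ℝ → ℝ} (hD : 0 ≤ D)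
    (hr : 0 < r) (hf : LogRegular (logModulus D r) f) :
    LogRegular (fun R => logModulus D r (R / 2)) (lsvTransferRight f) := by
  have hmem : ∀ x ∈ Ioc (0 : ℝ) 1, (x + 1) / 2 ∈ Ioc (0 : ℝ) 1 := fun x hx =>
    ⟨by linarith [hx.1], by linarith [hx.2]⟩
  refine ⟨fun x hx => div_nonneg (hf.1 _ (hmem x hx)) two_pos.le, fun x hx y hy hxy => ?_⟩
  have hxy' : (x + 1) / 2 ≤ (y + 1) / 2 := by linarith
  obtain ⟨h1, h2⟩ := hf.2 _ (hmem x hx) _ (hmem y hy) hxy'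
  have hx0 := hx.1
  have hy0 := hy.1
  have hlog : Real.log ((y + 1) / 2 / ((x + 1) / 2)) ≤ Real.log (y / x) / 2 := by
    have h3 : ((y + 1) / 2 / ((x + 1) / 2)) ^ 2 ≤ y / x := by
      rw [div_pow, div_le_div_iff₀ (by positivity) (by positivity)]
      nlinarith [mul_nonneg (sub_nonneg.2 hxy) (sub_nonneg.2
        (mul_le_one₀ hx.2 hy0.le hy.2))]
    have h4 := Real.log_le_log (by positivity) h3
    rw [Real.log_pow] at h4
    push_cast at h4
    linarith
  have h0 := log_div_nonneg (hmem x hx).1 hxy'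
  have hω := logModulus_mono hD hr h0 hlog
  have hexp : Real.exp (logModulus D r (Real.log ((y + 1) / 2 / ((x + 1) / 2)))) ≤
      Real.exp (logModulus D r (Real.log (y / x) / 2)) := Real.exp_le_exp.2 (by linarith)
  have hfx := mul_le_mul_of_nonneg_right hexp (hf.1 _ (hmem x hx))
  have hfy := mul_le_mul_of_nonneg_right hexp (hf.1 _ (hmem y hy))
  unfold _root_.lsvTransferRight
  constructor <;> linarith

theorem LogRegular.add {ω : ℝ → ℝ} {f g : ℝ → ℝ} (hf : LogRegular ω f) (hg : LogRegular ω g) :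
    LogRegular ω fun x => f x + g x := by
  refine ⟨fun x hx => add_nonneg (hf.1 x hx) (hg.1 x hx), fun x hx y hy hxy => ?_⟩
  obtain ⟨h1, h2⟩ := hf.2 x hx y hy hxy
  obtain ⟨h3, h4⟩ := hg.2 x hx y hy hxy
  constructor <;> linarith

/-- A function with a strictly better modulus remains regular after subtracting a small
constant. -/
theorem LogRegular.sub_const {D r b c : ℝ} {f : ℝ → ℝ} (hD : 0 ≤ D) (hr : 0 < r) (hr1 : r ≤ 1)
    (hf : LogRegular (fun R => logModulus D r (R / 2)) f)
    (hb : ∀ x ∈ Ioc (0 : ℝ) 1, b ≤ f x) (hcb : c ≤ (1 - (1 / 2) ^ r) * b) :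
    LogRegular (logModulus D r) fun x => f x - c := by
  have hθ0 : (0 : ℝ) < (1 / 2) ^ r := by positivity
  have hθ1 : (1 / 2 : ℝ) ^ r < 1 := Real.rpow_lt_one (by norm_num) (by norm_num) hr
  set θ : ℝ := (1 / 2) ^ r with hθ
  have hcf : ∀ x ∈ Ioc (0 : ℝ) 1, c ≤ (1 - θ) * f x := fun x hx =>
    hcb.trans (mul_le_mul_of_nonneg_left (hb x hx) (by linarith))
  have key : ∀ R, 0 ≤ R → ∀ z ∈ Ioc (0 : ℝ) 1,
      Real.exp (logModulus D r (R / 2)) * f z - c ≤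
        Real.exp (logModulus D r R) * (f z - c) := by
    intro R hR z hz
    have h1 : Real.exp (logModulus D r (R / 2)) ≤ θ * Real.exp (logModulus D r R) + (1 - θ) := by
      have h2 := convexOn_exp.2 (mem_univ (logModulus D r R)) (mem_univ 0) hθ0.le
        (sub_nonneg.2 hθ1.le) (by ring)
      simp only [smul_eq_mul, mul_zero, add_zero, Real.exp_zero, mul_one] at h2
      exact (Real.exp_le_exp.2 (logModulus_half_le hr1 hR)).trans h2
    have h3 : 1 ≤ Real.exp (logModulus D r R) := Real.one_le_exp (logModulus_nonneg hD hR)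
    have h4 := mul_le_mul_of_nonneg_right h1 (hf.1 z hz)
    have h5 := mul_le_mul_of_nonneg_right (hcf z hz) (sub_nonneg.2 h3)
    nlinarith
  refine ⟨fun x hx => ?_, fun x hx y hy hxy => ?_⟩
  · have := mul_nonneg hθ0.le (hf.1 x hx)
    linarith [hcf x hx]
  · obtain ⟨h1, h2⟩ := hf.2 x hx y hy hxy
    have h0 := log_div_nonneg hx.1 hxy
    exact ⟨(sub_le_sub_right h1 c).trans (key _ h0 y hy),
      (sub_le_sub_right h2 c).trans (key _ h0 x hx)⟩

/-- Any two values of a regular function on `[x₀, 1]` are comparable. -/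
theorem LogRegular.le_mul {D r x₀ x y : ℝ} {f : ℝ → ℝ} (hD : 0 ≤ D) (hr : 0 < r)
    (hf : LogRegular (logModulus D r) f) (hx₀ : 0 < x₀) (hx : x ∈ Icc x₀ 1) (hy : y ∈ Icc x₀ 1) :
    f x ≤ Real.exp (logModulus D r (Real.log (1 / x₀))) * f y := by
  have hmem : ∀ z ∈ Icc x₀ 1, z ∈ Ioc (0 : ℝ) 1 := fun z hz => ⟨hx₀.trans_le hz.1, hz.2⟩
  have key : ∀ u ∈ Icc x₀ 1, ∀ v ∈ Icc x₀ 1, u ≤ v →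
      Real.exp (logModulus D r (Real.log (v / u))) ≤
        Real.exp (logModulus D r (Real.log (1 / x₀))) := by
    intro u hu v hv huv
    have hu0 := (hmem u hu).1
    have hv0 := (hmem v hv).1
    have h1 : Real.log (v / u) ≤ Real.log (1 / x₀) := by
      refine Real.log_le_log (by positivity) ?_
      rw [div_le_div_iff₀ hu0 hx₀]
      nlinarith [hu.1, hv.2]
    have h2 := logModulus_mono hD hr (log_div_nonneg hu0 huv) h1
    exact Real.exp_le_exp.2 (by linarith)
  rcases le_total x y with h | h
  · exact (hf.2 x (hmem x hx) y (hmem y hy) h).1.trans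
      (mul_le_mul_of_nonneg_right (key x hx y hy h) (hf.1 y (hmem y hy)))
  · exact (hf.2 y (hmem y hy) x (hmem x hx) h).2.trans
      (mul_le_mul_of_nonneg_right (key y hy x hx h) (hf.1 y (hmem y hy)))

/-- Adding one to a nonnegative Hölder function makes it regular. -/
theorem logRegular_add_one {D r : ℝ} {f : ℝ → ℝ} (hD : 0 ≤ D) (hr : 0 < r)
    (hf0 : ∀ x, 0 ≤ f x)
    (hf : ∀ x ∈ Icc (0 : ℝ) 1, ∀ y ∈ Icc (0 : ℝ) 1, |f x - f y| ≤ D * |x - y| ^ r) :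
    LogRegular (logModulus D r) fun x => f x + 1 := by
  refine ⟨fun x _ => by linarith [hf0 x], fun x hx y hy hxy => ?_⟩
  have h := hf x ⟨hx.1.le, hx.2⟩ y ⟨hy.1.le, hy.2⟩
  have hlog : |x - y| ≤ Real.log (y / x) := by
    have hx0 := hx.1
    have hy0 := hy.1
    have h1 := Real.one_sub_inv_le_log_of_pos (show 0 < y / x by positivity)
    have h2 : y - x ≤ (y - x) / y := (le_div_iff₀ hy0).2 (by nlinarith [hy.2])
    rw [abs_sub_comm, abs_of_nonneg (by linarith)]
    calc y - x ≤ (y - x) / y := h2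
      _ = 1 - (y / x)⁻¹ := by field_simp
      _ ≤ _ := h1
  have h3 : D * |x - y| ^ r ≤ logModulus D r (Real.log (y / x)) := by
    have h4 := mul_le_mul_of_nonneg_left (Real.rpow_le_rpow (abs_nonneg _) hlog hr.le) hD
    have h5 := log_div_nonneg hx.1 hxy
    unfold logModulus
    linarith
  have h6 := Real.add_one_le_exp (logModulus D r (Real.log (y / x)))
  have h7 := logModulus_nonneg (r := r) hD (log_div_nonneg hx.1 hxy)
  have h8 := abs_le.1 (h.trans h3)
  set W := logModulus D r (Real.log (y / x))
  have h9 : ∀ z, (1 + W) * (f z + 1) ≤ Real.exp W * (f z + 1) := fun z =>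
    mul_le_mul_of_nonneg_right (by linarith) (by linarith [hf0 z])
  constructor
  · nlinarith [h9 y, mul_nonneg h7 (hf0 y)]
  · nlinarith [h9 x, mul_nonneg h7 (hf0 x)]

/-- The backward orbit of `x` under the left branches with indices `n, n - 1, …, k + 1`. -/
def lsvPullback (γs : ℕ → ℝ) (k : ℕ) : ℕ → ℝ → ℝ
  | 0, x => x
  | n + 1, x => if k ≤ n then lsvPullback γs k n (lsvLeftInv (γs (n + 1)) x) else x

/-- The number of indices in `{1, …, n}` with parameter at most `β`. -/
def goodCount (γs : ℕ → ℝ) (β : ℝ) (n : ℕ) : ℕ := ((Finset.Icc 1 n).filter fun k => γs k ≤ β).card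

theorem goodCount_succ (γs : ℕ → ℝ) (β : ℝ) (n : ℕ) :
    goodCount γs β (n + 1) = goodCount γs β n + if γs (n + 1) ≤ β then 1 else 0 := by
  unfold goodCount
  rw [← Finset.insert_Icc_right_eq_Icc_add_one (by omega), Finset.filter_insert]
  split_ifs with h
  · rw [Finset.card_insert_of_notMem (by simp)]
  · simp

theorem goodCount_mono (γs : ℕ → ℝ) (β : ℝ) : Monotone (goodCount γs β) :=
  monotone_nat_of_le_succ fun n => by rw [goodCount_succ]; exact Nat.le_add_right _ _

theorem goodCount_eq_self {γs : ℕ → ℝ} {β : ℝ} (h : ∀ n, 1 ≤ n → γs n ≤ β) (n : ℕ) :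
    goodCount γs β n = n := by
  rw [goodCount, Finset.filter_true_of_mem fun k hk => h k (Finset.mem_Icc.1 hk).1]
  simp

section Pullback

variable {γs : ℕ → ℝ}

theorem lsvPullback_of_le {k n : ℕ} (h : n ≤ k) (x : ℝ) : lsvPullback γs k n x = x := by
  cases n with
  | zero => rfl
  | succ n => rw [lsvPullback, if_neg (by omega)]

theorem lsvPullback_succ {k n : ℕ} (h : k ≤ n) (x : ℝ) :
    lsvPullback γs k (n + 1) x = lsvPullback γs k n (lsvLeftInv (γs (n + 1)) x) := by
  rw [lsvPullback, if_pos h]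

theorem lsvPullback_mem (hγ : ∀ n, 1 ≤ n → 0 < γs n) (k n : ℕ) {x : ℝ}
    (hx : x ∈ Ioc (0 : ℝ) 1) : lsvPullback γs k n x ∈ Ioc 0 x := by
  induction n generalizing x with
  | zero => exact ⟨hx.1, le_rfl⟩
  | succ n ih =>
    rcases le_or_gt k n with h | h
    · rw [lsvPullback_succ h]
      have hγn := hγ (n + 1) (by omega)
      have h1 := lsvLeftInv_mem hγn hx
      have h2 := ih (Ioc_subset_Ioc_right (by norm_num) h1)
      exact ⟨h2.1, h2.2.trans (lsvLeftInv_le hγn hx)⟩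
    · rw [lsvPullback_of_le h]
      exact ⟨hx.1, le_rfl⟩

theorem lsvLeft_rpow_neg {γ β y : ℝ} (hγ : 0 < γ) (hβ : β ∈ Ioo (0 : ℝ) 1)
    (hy : y ∈ Ioc (0 : ℝ) (1 / 2)) :
    lsvLeft γ y ^ (-β) + (2 ^ β - 1) * (if γ ≤ β then 1 else 0) ≤ y ^ (-β) := by
  have hy0 := hy.1
  have hu : 0 ≤ 2 ^ γ * y ^ γ := by positivity
  have hx0 : 0 < lsvLeft γ y := by unfold lsvLeft; positivity
  have hle : y ≤ lsvLeft γ y := by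
    unfold lsvLeft
    nlinarith
  split_ifs with h
  · have h2y : 2 * y ≤ 1 := by linarith [hy.2]
    have huv : (2 * y) ^ β ≤ (2 * y) ^ γ :=
      Real.rpow_le_rpow_of_exponent_ge (by positivity) h2y h
    have hv1 : (2 * y) ^ β ≤ 1 := Real.rpow_le_one (by positivity) h2y hβ.1.le
    have hv0 : 0 ≤ (2 * y) ^ β := by positivity
    have hxe : lsvLeft γ y = y * (1 + (2 * y) ^ γ) := by
      rw [lsvLeft, Real.mul_rpow two_pos.le hy0.le]
    have hx2 : lsvLeft γ y ≤ 2 * y := by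
      have : (2 * y) ^ γ ≤ 1 := Real.rpow_le_one (by positivity) h2y hγ.le
      rw [hxe]
      nlinarith
    have hconc := (Real.concaveOn_rpow hβ.1.le hβ.2.le).2 (mem_Ici.2 zero_le_one)
      (mem_Ici.2 zero_le_two) (sub_nonneg.2 hv1) hv0 (by ring)
    simp only [smul_eq_mul, Real.one_rpow, mul_one] at hconc
    have hpow : 1 + (2 ^ β - 1) * (2 * y) ^ β ≤ (1 + (2 * y) ^ γ) ^ β := by
      refine le_trans (by linarith) (hconc.trans ?_)
      exact Real.rpow_le_rpow (by linarith) (by linarith) hβ.1.le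
    have hone : 1 ≤ lsvLeft γ y ^ (-β) * (2 * y) ^ β := by
      rw [Real.rpow_neg hx0.le, inv_mul_eq_div, one_le_div (by positivity)]
      exact Real.rpow_le_rpow hx0.le hx2 hβ.1.le
    have hyx : y ^ (-β) = lsvLeft γ y ^ (-β) * (1 + (2 * y) ^ γ) ^ β := by
      rw [hxe, Real.mul_rpow hy0.le (by positivity), mul_assoc, ← Real.rpow_add (by positivity)]
      simp
    have hc : (0 : ℝ) ≤ 2 ^ β - 1 := sub_nonneg.2 (Real.one_le_rpow one_le_two hβ.1.le)
    have hX : 0 < lsvLeft γ y ^ (-β) := by positivity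
    rw [hyx]
    have h1 := mul_le_mul_of_nonneg_left hpow hX.le
    have h2 := mul_le_mul_of_nonneg_left hone hc
    linarith
  · rw [mul_zero, add_zero]
    exact Real.rpow_le_rpow_of_nonpos hy0 hle (by linarith [hβ.1])

theorem lsvPullback_rpow_neg (hγ : ∀ n, 1 ≤ n → 0 < γs n) {β : ℝ} (hβ : β ∈ Ioo (0 : ℝ) 1)
    {k n : ℕ} (hkn : k ≤ n) {x : ℝ} (hx : x ∈ Ioc (0 : ℝ) 1) :
    x ^ (-β) + (2 ^ β - 1) * ((goodCount γs β n : ℝ) - goodCount γs β k) ≤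
      lsvPullback γs k n x ^ (-β) := by
  induction n, hkn using Nat.le_induction generalizing x with
  | base => rw [lsvPullback_of_le le_rfl]; simp
  | succ n hkn ih =>
    have hγn := hγ (n + 1) (by omega)
    have h1 := lsvLeftInv_mem hγn hx
    have h2 := ih (Ioc_subset_Ioc_right (by norm_num) h1)
    have h3 := lsvLeft_rpow_neg hγn hβ h1
    rw [lsvLeft_lsvLeftInv hγn hx] at h3
    rw [lsvPullback_succ hkn, goodCount_succ]
    push_cast
    linarith

/-- Quantitative decay of backward orbits in terms of the number of good maps. -/
theorem lsvPullback_le (hγ : ∀ n, 1 ≤ n → 0 < γs n) {β : ℝ} (hβ : β ∈ Ioo (0 : ℝ) 1)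
    {k n : ℕ} (hkn : k ≤ n) {x : ℝ} (hx : x ∈ Ioc (0 : ℝ) 1) {L : ℝ} (hL : 0 < L)
    (hLc : L ≤ 1 + ((goodCount γs β n : ℝ) - goodCount γs β k)) :
    lsvPullback γs k n x ≤ (2 ^ β - 1) ^ (-(1 / β)) * L ^ (-(1 / β)) := by
  have hβ0 := hβ.1
  have hc : (0 : ℝ) < 2 ^ β - 1 := sub_pos.2 (Real.one_lt_rpow one_lt_two hβ0)
  have hc1 : (2 : ℝ) ^ β - 1 ≤ 1 := by
    have := Real.rpow_le_rpow_of_exponent_le (one_le_two (α := ℝ)) hβ.2.le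
    rw [Real.rpow_one] at this
    linarith
  have h1 := lsvPullback_rpow_neg hγ hβ hkn hx
  have h2 : 1 ≤ x ^ (-β) := Real.one_le_rpow_of_pos_of_le_one_of_nonpos hx.1 hx.2 (by linarith)
  have hG := (lsvPullback_mem hγ k n hx).1
  have h3 : (2 ^ β - 1) * L ≤ lsvPullback γs k n x ^ (-β) := by
    have := mul_le_mul_of_nonneg_left hLc hc.le
    linarith
  have h4 := Real.rpow_le_rpow_of_nonpos (by positivity) h3
    (by simpa using hβ0.le : -(1 / β) ≤ 0)
  rwa [← Real.rpow_mul hG.le, neg_mul_neg, mul_one_div_cancel hβ0.ne', Real.rpow_one,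
    Real.mul_rpow hc.le hL.le] at h4

end Pullback

/-- The prescribed mass of the uncoupled part after `n` steps. -/
def massSchedule (p : ℝ) (n₀ n : ℕ) : ℝ := 2 * ((n₀ : ℝ) / (n₀ + n)) ^ p

section Schedule

variable {p : ℝ} {n₀ : ℕ}

theorem massSchedule_pos (p : ℝ) (hn₀ : 0 < n₀) (n : ℕ) : 0 < massSchedule p n₀ n := by
  unfold massSchedule
  positivity

theorem massSchedule_zero (p : ℝ) (hn₀ : 0 < n₀) : massSchedule p n₀ 0 = 2 := by
  have : (n₀ : ℝ) ≠ 0 := by positivity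
  simp [massSchedule, div_self this]

theorem massSchedule_eq (p : ℝ) (n₀ n : ℕ) :
    massSchedule p n₀ n = 2 * (n₀ : ℝ) ^ p * ((n + n₀ : ℕ) : ℝ) ^ (-p) := by
  rw [massSchedule, Real.div_rpow (by positivity) (by positivity), Real.rpow_neg (by positivity)]
  push_cast
  rw [add_comm (n : ℝ)]
  ring

theorem massSchedule_le_two (hp : 0 < p) (n : ℕ) : massSchedule p n₀ n ≤ 2 := by
  have h : (n₀ : ℝ) / (n₀ + n) ≤ 1 := div_le_one_of_le₀ (by simp) (by positivity)
  have := Real.rpow_le_one (by positivity) h hp.le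
  unfold massSchedule
  linarith

theorem massSchedule_le (hp : 0 < p) {n : ℕ} (hn : 1 ≤ n) :
    massSchedule p n₀ n ≤ 2 * (n₀ : ℝ) ^ p * (n : ℝ) ^ (-p) := by
  rw [massSchedule_eq]
  have hn' : (0 : ℝ) < n := by positivity
  gcongr ?_ * ?_
  exact Real.rpow_le_rpow_of_nonpos hn' (by simp) (by linarith)

theorem le_massSchedule (hp : 0 < p) (hn₀ : 0 < n₀) {n : ℕ} (hn : n ≤ n₀) :
    2 * 2 ^ (-p) ≤ massSchedule p n₀ n := by
  have hn' : (n : ℝ) ≤ n₀ := by exact_mod_cast hn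
  have h : (2 : ℝ)⁻¹ ≤ (n₀ : ℝ) / (n₀ + n) := by
    rw [inv_eq_one_div, div_le_div_iff₀ two_pos (by positivity)]
    linarith
  rw [Real.rpow_neg two_pos.le, ← Real.inv_rpow two_pos.le, massSchedule]
  gcongr

theorem le_massSchedule_of_le (hp : 0 < p) {n : ℕ} (hn₀ : 0 < n₀) (hn : n₀ ≤ n) :
    2 * 2 ^ (-p) * (n₀ : ℝ) ^ p * (n : ℝ) ^ (-p) ≤ massSchedule p n₀ n := by
  have hn' : (n₀ : ℝ) ≤ n := by exact_mod_cast hn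
  have hn1 : (0 : ℝ) < n := by
    have : 0 < n := by omega
    positivity
  have h : ((2 : ℝ) * n) ^ (-p) ≤ ((n + n₀ : ℕ) : ℝ) ^ (-p) := by
    refine Real.rpow_le_rpow_of_nonpos (by positivity) ?_ (by linarith)
    push_cast
    linarith
  rw [massSchedule_eq]
  rw [Real.mul_rpow two_pos.le hn1.le] at h
  calc _ = 2 * (n₀ : ℝ) ^ p * (2 ^ (-p) * (n : ℝ) ^ (-p)) := by ring
    _ ≤ _ := by gcongr

theorem massSchedule_le_mul (hp : 0 < p) {k n : ℕ} (hn₀ : 0 < n₀) (hk : n ≤ 2 * k) :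
    massSchedule p n₀ k ≤ 2 ^ p * massSchedule p n₀ n := by
  have hk' : (n : ℝ) ≤ 2 * k := by exact_mod_cast hk
  have h : (n₀ : ℝ) / (n₀ + k) ≤ 2 * ((n₀ : ℝ) / (n₀ + n)) := by
    rw [mul_div_assoc', div_le_div_iff₀ (by positivity) (by positivity)]
    have : (0 : ℝ) ≤ n₀ := by positivity
    nlinarith
  have h' := Real.rpow_le_rpow (by positivity) h hp.le
  rw [Real.mul_rpow two_pos.le (by positivity)] at h'
  unfold massSchedule
  linarith

theorem massSchedule_sub_le (hp : 1 ≤ p) (hn₀ : 0 < n₀) (n : ℕ) :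
    massSchedule p n₀ n - massSchedule p n₀ (n + 1) ≤ p / n₀ * massSchedule p n₀ n := by
  have hm : (1 : ℝ) ≤ n₀ := by exact_mod_cast hn₀
  have hd : (0 : ℝ) < n₀ + n + 1 := by positivity
  have h1 := one_add_mul_self_le_rpow_one_add
    (by rw [neg_le_neg_iff, div_le_one hd]; linarith [(Nat.cast_nonneg n : (0 : ℝ) ≤ n)] :
      -1 ≤ -(1 / ((n₀ : ℝ) + n + 1))) hp
  have h2 : (n₀ : ℝ) / (n₀ + (n + 1 : ℕ)) = n₀ / (n₀ + n) * (1 + -(1 / ((n₀ : ℝ) + n + 1))) := by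
    push_cast
    field_simp
    ring
  have h3 : 0 ≤ 1 + -(1 / ((n₀ : ℝ) + n + 1)) := by
    rw [← sub_eq_add_neg, sub_nonneg, div_le_one hd]
    linarith [(Nat.cast_nonneg n : (0 : ℝ) ≤ n)]
  have h4 : massSchedule p n₀ (n + 1) =
      massSchedule p n₀ n * (1 + -(1 / ((n₀ : ℝ) + n + 1))) ^ p := by
    rw [massSchedule, massSchedule, h2, Real.mul_rpow (by positivity) h3]
    ring
  have hM := massSchedule_pos p hn₀ n
  have h5 : 1 / ((n₀ : ℝ) + n + 1) ≤ 1 / n₀ := by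
    gcongr
    linarith [(Nat.cast_nonneg n : (0 : ℝ) ≤ n)]
  have h6 : 1 - p / n₀ ≤ (1 + -(1 / ((n₀ : ℝ) + n + 1))) ^ p := by
    have := mul_le_mul_of_nonneg_left h5 (by linarith : 0 ≤ p)
    rw [mul_one_div p (n₀ : ℝ)] at this
    linarith
  have := mul_le_mul_of_nonneg_left h6 hM.le
  rw [h4]
  linarith

end Schedule

/-- Truncations of a summable sequence at a small height have a small sum. -/
theorem exists_sum_min_le {g : ℕ → ℝ} (hg : Summable g) (hg0 : ∀ j, 0 ≤ g j) {ε : ℝ} (hε : 0 < ε) :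
    ∃ x₀ ∈ Ioc (0 : ℝ) (1 / 2), x₀ ≤ ε ∧ ∀ n, ∑ j ∈ Finset.range n, min x₀ (g j) ≤ ε := by
  have h := tendsto_tsum_of_dominated_convergence (𝓕 := nhdsWithin (0 : ℝ) (Ioi 0))
    (f := fun x j => min x (g j)) (g := fun j => min 0 (g j)) (bound := g) hg ?_ ?_
  · simp only [min_eq_left (hg0 _), tsum_zero] at h
    have h1 := h.eventually (gt_mem_nhds hε)
    have h2 : ∀ᶠ x in nhdsWithin (0 : ℝ) (Ioi 0), x ∈ Ioc (0 : ℝ) (min (1 / 2) ε) :=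
      Ioc_mem_nhdsGT (by positivity)
    obtain ⟨x, hx1, hx2⟩ := (h1.and h2).exists
    refine ⟨x, ⟨hx2.1, hx2.2.trans (min_le_left _ _)⟩, hx2.2.trans (min_le_right _ _),
      fun n => le_trans ?_ hx1.le⟩
    have h0 : ∀ j, 0 ≤ min x (g j) := fun j => le_min hx2.1.le (hg0 j)
    exact Summable.sum_le_tsum _ (fun j _ => h0 j)
      (hg.of_nonneg_of_le h0 fun j => min_le_right _ _)
  · intro j
    have : Continuous fun x : ℝ => min x (g j) := by fun_prop
    exact (this.tendsto 0).mono_left nhdsWithin_le_nhds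
  · filter_upwards [self_mem_nhdsWithin] with x hx j
    have hx : 0 < x := hx
    rw [Real.norm_of_nonneg (le_min hx.le (hg0 j))]
    exact min_le_right _ _

section Tail

variable {γs : ℕ → ℝ} {γstar γ : ℝ}

/-- The mass of the uncoupled part which is close to the neutral fixed point is at most half of
the total mass prescribed by the schedule. -/
theorem exists_pullback_sum_le (hmem : ∀ n, 1 ≤ n → 0 < γs n) (hstar : γstar ∈ Ioo (0 : ℝ) 1)
    (hub : ∀ n, 1 ≤ n → γs n ≤ γstar) (hγ : γ ∈ Ioo (0 : ℝ) 1)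
    {c : ℝ} (hc : 0 < c) {N₁ : ℕ}
    (hcount : ∀ n, N₁ ≤ n → c * n ≤ (goodCount γs γ n : ℝ) - goodCount γs γ (n / 2 + 1))
    {F C : ℝ} (hF : 0 ≤ F) (hC : 0 ≤ C) :
    ∃ x₀ ∈ Ioc (0 : ℝ) (1 / 2), ∀ᶠ n₀ : ℕ in atTop, ∀ n : ℕ,
      F * lsvPullback γs 0 n x₀ + C * ∑ k ∈ Finset.range n,
        massSchedule (1 / γ) n₀ k * lsvPullback γs (k + 1) n x₀ ≤
          massSchedule (1 / γ) n₀ n / 2 := by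
  set p := 1 / γ with hp_def
  have hp : 1 < p := (one_lt_div hγ.1).2 hγ.2
  have hp0 : 0 < p := one_pos.trans hp
  set q := 1 / γstar with hq_def
  have hq : 1 < q := (one_lt_div hstar.1).2 hstar.2
  set A : ℝ := (2 ^ γstar - 1) ^ (-q) with hA_def
  have hA : 0 < A := Real.rpow_pos_of_pos (sub_pos.2 (Real.one_lt_rpow one_lt_two hstar.1)) _
  set B : ℝ := (2 ^ γ - 1) ^ (-p) * c ^ (-p) with hB_def
  have hB : 0 < B := mul_pos
    (Real.rpow_pos_of_pos (sub_pos.2 (Real.one_lt_rpow one_lt_two hγ.1)) _)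
    (Real.rpow_pos_of_pos hc _)
  set g : ℕ → ℝ := fun j => A * ((j + 1 : ℕ) : ℝ) ^ (-q) with hg_def
  have hg0 : ∀ j, 0 ≤ g j := fun j => by positivity
  have hg : Summable g := by
    refine Summable.mul_left A ?_
    exact (summable_nat_add_iff (f := fun j : ℕ => (j : ℝ) ^ (-q)) 1).2
      (Real.summable_nat_rpow.2 (by linarith))
  have h2p : (0 : ℝ) < 2 ^ (-p) := by positivity
  set ε : ℝ := 2 ^ (-p) / (8 * (F + C + 1)) with hε_def
  have hε : 0 < ε := by positivity
  have hεeq : ε * (F + C + 1) = 2 ^ (-p) / 8 := by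
    rw [hε_def]
    field_simp
  have hFε : 0 ≤ ε * F := by positivity
  have hCε : 0 ≤ ε * C := by positivity
  obtain ⟨x₀, hx₀, hx₀ε, hsum⟩ := exists_sum_min_le hg hg0 hε
  have hx₀1 : x₀ ∈ Ioc (0 : ℝ) 1 := Ioc_subset_Ioc_right (by norm_num) hx₀
  have hG : ∀ k n, lsvPullback γs k n x₀ ∈ Ioc 0 x₀ := fun k n => lsvPullback_mem hmem k n hx₀1
  have hGmin : ∀ n, ∀ k ∈ Finset.range n, lsvPullback γs (k + 1) n x₀ ≤
      min x₀ (g (n - 1 - k)) := by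
    intro n k hk
    have hk : k < n := Finset.mem_range.1 hk
    refine le_min (hG _ _).2 ?_
    refine lsvPullback_le hmem hstar hk hx₀1 (by positivity) ?_
    rw [goodCount_eq_self hub, goodCount_eq_self hub, ← Nat.cast_sub hk]
    have : n - 1 - k + 1 = 1 + (n - (k + 1)) := by omega
    rw [this]
    push_cast
    exact le_rfl
  have hGsum : ∀ n, ∑ k ∈ Finset.range n, min x₀ (g (n - 1 - k)) ≤ ε := fun n => by
    rw [Finset.sum_range_reflect fun j => min x₀ (g j)]
    exact hsum n
  have hGfar : ∀ n, N₁ ≤ n → 1 ≤ n → ∀ k, k ≤ n → k ≤ n / 2 + 1 →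
      lsvPullback γs k n x₀ ≤ B * (n : ℝ) ^ (-p) := by
    intro n hn hn1 k hk hk2
    have hn0 : (0 : ℝ) < n := by positivity
    rw [hB_def, mul_assoc, ← Real.mul_rpow hc.le hn0.le]
    refine lsvPullback_le hmem hγ hk hx₀1 (by positivity) ?_
    have h1 := hcount n hn
    have h2 : (goodCount γs γ k : ℝ) ≤ goodCount γs γ (n / 2 + 1) := by
      exact_mod_cast goodCount_mono γs γ hk2
    linarith
  have hsp : Summable fun k : ℕ => (k : ℝ) ^ (-p) := Real.summable_nat_rpow.2 (by linarith)
  have hev1 : ∀ᶠ n₀ : ℕ in atTop, C * B * ∑' k : ℕ, ((k + n₀ : ℕ) : ℝ) ^ (-p) ≤ 2 ^ (-p) / 8 := by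
    have h := (tendsto_sum_nat_add fun k : ℕ => (k : ℝ) ^ (-p)).const_mul (C * B)
    rw [mul_zero] at h
    exact (h.eventually (gt_mem_nhds (by positivity : (0 : ℝ) < 2 ^ (-p) / 8))).mono
      fun _ h => h.le
  have hev2 : ∀ᶠ n₀ : ℕ in atTop, F * B / (2 ^ (-p) / 4) ≤ (n₀ : ℝ) ^ p :=
    ((tendsto_rpow_atTop hp0).comp tendsto_natCast_atTop_atTop).eventually_ge_atTop _
  refine ⟨x₀, hx₀, ?_⟩
  filter_upwards [hev1, hev2, eventually_ge_atTop N₁, eventually_ge_atTop 1]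
    with n₀ hn1 hn2 hN₁ hn₀ n
  rw [div_le_iff₀ (by positivity)] at hn2
  have hM0 : ∀ k, 0 < massSchedule p n₀ k := massSchedule_pos p hn₀
  rcases le_or_gt n n₀ with hn | hn
  · have h1 : ∑ k ∈ Finset.range n, massSchedule p n₀ k * lsvPullback γs (k + 1) n x₀ ≤
        2 * ε := by
      refine le_trans (Finset.sum_le_sum fun k hk => mul_le_mul (massSchedule_le_two hp0 k)
        (hGmin n k hk) (hG _ _).1.le two_pos.le) ?_
      rw [← Finset.mul_sum]
      linarith [hGsum n]
    have h2 := le_massSchedule hp0 hn₀ hn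
    have h3 := mul_le_mul_of_nonneg_left h1 hC
    have h4 := mul_le_mul_of_nonneg_left ((hG 0 n).2.trans hx₀ε) hF
    linarith
  · set w : ℝ := (n₀ : ℝ) ^ p * (n : ℝ) ^ (-p) with hw_def
    have hw : 0 ≤ w := by positivity
    set M := massSchedule p n₀ n with hM_def
    have hMw : 2 * 2 ^ (-p) * w ≤ M := by
      have := le_massSchedule_of_le hp0 hn₀ hn.le
      rwa [mul_assoc] at this
    have hM : 0 < M := hM0 n
    have hnp : 0 ≤ (n : ℝ) ^ (-p) := by positivity
    have hterm : ∀ k ∈ Finset.range n,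
        massSchedule p n₀ k * lsvPullback γs (k + 1) n x₀ ≤
          2 ^ p * M * min x₀ (g (n - 1 - k)) + 2 * B * w * ((k + n₀ : ℕ) : ℝ) ^ (-p) := by
      intro k hk
      have hm0 : 0 ≤ min x₀ (g (n - 1 - k)) := le_min hx₀.1.le (hg0 _)
      rcases le_or_gt n (2 * k) with h | h
      · have h1 := mul_le_mul (massSchedule_le_mul hp0 hn₀ h) (hGmin n k hk) (hG _ _).1.le
          (by positivity)
        have h2 : 0 ≤ 2 * B * w * ((k + n₀ : ℕ) : ℝ) ^ (-p) := by positivity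
        linarith
      · have h1 := mul_le_mul_of_nonneg_left
          (hGfar n (by omega) (by omega) (k + 1) (by omega) (by omega)) (hM0 k).le
        rw [massSchedule_eq] at h1 ⊢
        have h2 : 0 ≤ 2 ^ p * M * min x₀ (g (n - 1 - k)) := by positivity
        refine h1.trans ?_
        rw [hw_def]
        linarith
    have hS : ∑ k ∈ Finset.range n, ((k + n₀ : ℕ) : ℝ) ^ (-p) ≤
        ∑' k : ℕ, ((k + n₀ : ℕ) : ℝ) ^ (-p) :=
      Summable.sum_le_tsum _ (fun k _ => by positivity) ((summable_nat_add_iff n₀).2 hsp)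
    have h1 := Finset.sum_le_sum hterm
    rw [Finset.sum_add_distrib, ← Finset.mul_sum, ← Finset.mul_sum] at h1
    have h2 : 2 ^ p * M * ∑ k ∈ Finset.range n, min x₀ (g (n - 1 - k)) ≤ 2 ^ p * M * ε :=
      mul_le_mul_of_nonneg_left (hGsum n) (by positivity)
    have h3 : C * (2 ^ p * M * ε) ≤ M / 8 := by
      have h4 : C * ε ≤ 2 ^ (-p) / 8 := by linarith
      have h5 : (2 : ℝ) ^ p * 2 ^ (-p) = 1 := by
        rw [← Real.rpow_add two_pos, add_neg_cancel, Real.rpow_zero]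
      have h6 := mul_le_mul_of_nonneg_left h4 (by positivity : 0 ≤ 2 ^ p * M)
      calc C * (2 ^ p * M * ε) = 2 ^ p * M * (C * ε) := by ring
        _ ≤ 2 ^ p * M * (2 ^ (-p) / 8) := h6
        _ = 2 ^ p * 2 ^ (-p) * (M / 8) := by ring
        _ = M / 8 := by rw [h5, one_mul]
    have h4 : C * (2 * B * w * ∑ k ∈ Finset.range n, ((k + n₀ : ℕ) : ℝ) ^ (-p)) ≤ M / 8 := by
      have h5 := mul_le_mul_of_nonneg_left hS (by positivity : 0 ≤ C * B)
      have h6 := mul_le_mul_of_nonneg_left (h5.trans hn1) (by positivity : 0 ≤ 2 * w)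
      linarith
    have h5 : F * lsvPullback γs 0 n x₀ ≤ M / 8 := by
      have h6 := mul_le_mul_of_nonneg_left
        (hGfar n (by omega) (by omega) 0 (by omega) (by omega)) hF
      have h7 := mul_le_mul_of_nonneg_right hn2 hnp
      linarith
    have h6 := mul_le_mul_of_nonneg_left h1 hC
    have h7 := mul_le_mul_of_nonneg_left h2 hC
    linarith

end Tail

section Regular

variable {D r : ℝ} {f : ℝ → ℝ}

theorem LogRegular.setIntegral_le (hD : 0 ≤ D) (hr : 0 < r) (hf : LogRegular (logModulus D r) f)
    (hfi : IntegrableOn f (Ioc 0 1)) {x₀ y : ℝ} (hx₀ : 0 < x₀) (hy : y ∈ Icc x₀ 1) :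
    ∫ t in Ioc x₀ 1, f t ≤ Real.exp (logModulus D r (Real.log (1 / x₀))) * f y := by
  have hfy := hf.1 y ⟨hx₀.trans_le hy.1, hy.2⟩
  have h := setIntegral_mono_on (hfi.mono_set (Ioc_subset_Ioc_left hx₀.le))
    (integrableOn_const (by simp)) measurableSet_Ioc
    fun t ht => hf.le_mul hD hr hx₀ (Ioc_subset_Icc_self ht) hy
  refine h.trans ?_
  rw [setIntegral_const, Real.volume_real_Ioc_of_le (hy.1.trans hy.2), smul_eq_mul]
  exact mul_le_of_le_one_left (by positivity) (by linarith)

theorem LogRegular.le_setIntegral (hD : 0 ≤ D) (hr : 0 < r) (hf : LogRegular (logModulus D r) f)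
    (hfi : IntegrableOn f (Ioc 0 1)) {x₀ y : ℝ} (hx₀ : 0 < x₀) (hy : y ∈ Icc x₀ 1) :
    (1 - x₀) * f y ≤
      Real.exp (logModulus D r (Real.log (1 / x₀))) * ∫ t in Ioc 0 1, f t := by
  have hi := hfi.mono_set (Ioc_subset_Ioc_left hx₀.le : Ioc x₀ 1 ⊆ Ioc 0 1)
  have h := setIntegral_mono_on (integrableOn_const (by simp)) (hi.const_mul _) measurableSet_Ioc
    fun t ht => hf.le_mul hD hr hx₀ hy (Ioc_subset_Icc_self ht)
  rw [setIntegral_const, Real.volume_real_Ioc_of_le (hy.1.trans hy.2), smul_eq_mul,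
    integral_const_mul] at h
  refine h.trans (mul_le_mul_of_nonneg_left ?_ (Real.exp_pos _).le)
  refine setIntegral_mono_set hfi ?_ (Ioc_subset_Ioc_left hx₀.le).eventuallyLE
  exact (ae_restrict_iff' measurableSet_Ioc).2 (.of_forall fun t ht => hf.1 t ht)

end Regular

/-- The uncoupled part: start from `f + 1` and in each step apply the transfer operator and remove
a constant so that the mass follows the schedule `M`. -/
def remainder (γs : ℕ → ℝ) (M : ℕ → ℝ) (f : ℝ → ℝ) : ℕ → ℝ → ℝ
  | 0 => fun x => f x + 1
  | n + 1 => fun x => lsvTransfer (γs (n + 1)) (remainder γs M f n) x - (M n - M (n + 1))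

theorem lsvTransfer_sub (γ : ℝ) (f g : ℝ → ℝ) (x : ℝ) :
    lsvTransfer γ (fun t => f t - g t) x = lsvTransfer γ f x - lsvTransfer γ g x := by
  unfold lsvTransfer lsvTransferLeft lsvTransferRight
  ring

section Remainder

variable {γs M : ℕ → ℝ} {D r F x₀ : ℝ} {f : ℝ → ℝ}

theorem remainder_spec (hmem : ∀ n, 1 ≤ n → γs n ∈ Ioo (0 : ℝ) 1) (hD : 0 ≤ D) (hr : 0 < r)
    (hr1 : r ≤ 1) (hfi : IntegrableOn f (Ioc 0 1)) (hf1 : ∫ x in Ioc 0 1, f x = 1)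
    (hF : ∀ x ∈ Ioc (0 : ℝ) 1, f x + 1 ≤ F)
    (hreg : LogRegular (logModulus D r) fun x => f x + 1)
    (hM0 : M 0 = 2) (hManti : ∀ n, M (n + 1) ≤ M n)
    (hx₀ : x₀ ∈ Ioc (0 : ℝ) (1 / 2))
    (htail : ∀ n, F * lsvPullback γs 0 n x₀ +
      Real.exp (logModulus D r (Real.log (1 / (1 / 2)))) * ∑ k ∈ Finset.range n,
        M k * lsvPullback γs (k + 1) n x₀ ≤ M n / 2)
    (hMstep : ∀ n, M n - M (n + 1) ≤ (1 - (1 / 2) ^ r) *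
      ((Real.exp (logModulus D r (Real.log (1 / x₀))))⁻¹ / 4 * M n)) (n : ℕ) :
    LogRegular (logModulus D r) (remainder γs M f n) ∧
      IntegrableOn (remainder γs M f n) (Ioc 0 1) ∧
      ∫ x in Ioc 0 1, remainder γs M f n x = M n ∧
      ∀ x ∈ Ioc (0 : ℝ) 1, ∫ t in Ioc 0 x, remainder γs M f n t ≤
        F * lsvPullback γs 0 n x + Real.exp (logModulus D r (Real.log (1 / (1 / 2)))) *
          ∑ k ∈ Finset.range n, M k * lsvPullback γs (k + 1) n x := by
  set E := Real.exp (logModulus D r (Real.log (1 / (1 / 2))))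
  have hE : 0 < E := Real.exp_pos _
  have hconst : ∀ (c : ℝ) (s : Set ℝ), s ⊆ Ioc 0 1 → IntegrableOn (fun _ : ℝ => c) s :=
    fun c _ hs =>
      (integrableOn_const (by simp) : IntegrableOn (fun _ : ℝ => c) (Ioc (0 : ℝ) 1)).mono_set hs
  induction n with
  | zero =>
    have hi : IntegrableOn (fun x => f x + 1) (Ioc 0 1) := hfi.add (hconst 1 _ le_rfl)
    refine ⟨hreg, hi, ?_, fun x hx => ?_⟩
    · rw [hM0]
      change ∫ x in Ioc 0 1, (f x + 1) = 2
      rw [integral_add hfi (hconst 1 _ le_rfl), hf1, setIntegral_const,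
        Real.volume_real_Ioc_of_le zero_le_one]
      norm_num
    · have hsub : Ioc 0 x ⊆ Ioc 0 1 := Ioc_subset_Ioc_right hx.2
      have h := setIntegral_mono_on (hi.mono_set hsub) (hconst F _ hsub) measurableSet_Ioc
        fun t ht => hF t (hsub ht)
      rw [setIntegral_const, Real.volume_real_Ioc_of_le hx.1.le, smul_eq_mul] at h
      simp only [Finset.range_zero, Finset.sum_empty, mul_zero, add_zero, lsvPullback]
      refine (le_of_eq rfl).trans (h.trans (le_of_eq ?_))
      ring
  | succ n ih =>
    obtain ⟨hR, hRi, hRm, hRt⟩ := ih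
    have hγn := hmem (n + 1) (by omega)
    set R := remainder γs M f n with hR_def
    set c := M n - M (n + 1) with hc_def
    have hx₀1 : x₀ ∈ Ioc (0 : ℝ) 1 := Ioc_subset_Ioc_right (by norm_num) hx₀
    have hdef : remainder γs M f (n + 1) = fun x =>
      lsvTransferLeft (γs (n + 1)) R x + (lsvTransferRight R x - c) := by
      funext x
      change lsvTransfer _ _ _ - _ = _
      rw [lsvTransfer, add_sub_assoc]
    set K := Real.exp (logModulus D r (Real.log (1 / x₀)))
    have hK : 0 < K := Real.exp_pos _
    have hmemR : ∀ x ∈ Ioc (0 : ℝ) 1, (x + 1) / 2 ∈ Icc (1 / 2 : ℝ) 1 := fun x hx =>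
      ⟨by linarith [hx.1], by linarith [hx.2]⟩
    have hlow : ∀ x ∈ Ioc (0 : ℝ) 1, K⁻¹ / 4 * M n ≤ lsvTransferRight R x := by
      intro x hx
      have h1 := hR.setIntegral_le hD hr hRi hx₀.1
        (Icc_subset_Icc_left hx₀.2 (hmemR x hx))
      have h2 := (hRt x₀ hx₀1).trans (htail n)
      have h3 : ∫ t in Ioc 0 1, R t = (∫ t in Ioc 0 x₀, R t) + ∫ t in Ioc x₀ 1, R t := by
        rw [← Ioc_union_Ioc_eq_Ioc hx₀1.1.le hx₀1.2]
        exact setIntegral_union (Ioc_disjoint_Ioc_of_le le_rfl) measurableSet_Ioc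
          (hRi.mono_set (Ioc_subset_Ioc_right hx₀1.2)) (hRi.mono_set (Ioc_subset_Ioc_left hx₀1.1.le))
      have h4 : M n / 2 ≤ K * R ((x + 1) / 2) := by linarith
      have h5 := mul_le_mul_of_nonneg_left h4 (inv_pos.2 hK).le
      rw [inv_mul_cancel_left₀ hK.ne'] at h5
      unfold lsvTransferRight
      linarith
    have hup : ∀ x ∈ Ioc (0 : ℝ) 1, lsvTransferRight R x ≤ E * M n := by
      intro x hx
      have h1 : (1 - 1 / 2) * R ((x + 1) / 2) ≤ E * ∫ t in Ioc 0 1, R t :=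
        hR.le_setIntegral hD hr hRi one_half_pos (hmemR x hx)
      rw [hRm] at h1
      unfold lsvTransferRight
      linarith
    have hLi := integrableOn_lsvTransferLeft_Ioc hγn.1 hRi
    have hPi := integrableOn_lsvTransfer hγn.1 hRi
    have hi : IntegrableOn (remainder γs M f (n + 1)) (Ioc 0 1) := hPi.sub (hconst c _ le_rfl)
    refine ⟨?_, hi, ?_, fun x hx => ?_⟩
    · rw [hdef]
      exact (hR.lsvTransferLeft hγn hD hr).add
        ((hR.lsvTransferRight hD hr).sub_const hD hr hr1 hlow (hMstep n))
    · change ∫ x in Ioc 0 1, (lsvTransfer (γs (n + 1)) R x - c) = M (n + 1)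
      rw [integral_sub hPi (hconst c _ le_rfl), integral_lsvTransfer hγn.1 hRi, hRm,
        setIntegral_const, Real.volume_real_Ioc_of_le zero_le_one]
      simp [hc_def]
    · have hsub : Ioc 0 x ⊆ Ioc 0 1 := Ioc_subset_Ioc_right hx.2
      have hinv : lsvLeftInv (γs (n + 1)) x ∈ Ioc (0 : ℝ) 1 :=
        Ioc_subset_Ioc_right (by norm_num) (lsvLeftInv_mem hγn.1 hx)
      have h1 : ∫ t in Ioc 0 x, remainder γs M f (n + 1) t ≤
          ∫ t in Ioc 0 x, (lsvTransferLeft (γs (n + 1)) R t + E * M n) := by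
        refine setIntegral_mono_on (hi.mono_set hsub)
          ((hLi.mono_set hsub).add (hconst _ _ hsub)) measurableSet_Ioc fun t ht => ?_
        rw [hdef]
        have h2 := hup t (hsub ht)
        have h3 : 0 ≤ c := sub_nonneg.2 (hManti n)
        dsimp only
        linarith
      rw [integral_add (hLi.mono_set hsub) (hconst _ _ hsub),
        setIntegral_lsvTransferLeft_Ioc hγn.1 hx, setIntegral_const,
        Real.volume_real_Ioc_of_le hx.1.le, smul_eq_mul] at h1
      have h2 := hRt _ hinv
      have h3 : ∑ k ∈ Finset.range n, M k * lsvPullback γs (k + 1) (n + 1) x =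
          ∑ k ∈ Finset.range n, M k * lsvPullback γs (k + 1) n (lsvLeftInv (γs (n + 1)) x) :=
        Finset.sum_congr rfl fun k hk => by rw [lsvPullback_succ (Finset.mem_range.1 hk)]
      rw [Finset.sum_range_succ, h3, lsvPullback_succ (Nat.zero_le n), lsvPullback_of_le le_rfl]
      linarith

end Remainder

theorem massSchedule_succ_le {p : ℝ} (hp : 0 < p) {n₀ : ℕ} (hn₀ : 0 < n₀) (n : ℕ) :
    massSchedule p n₀ (n + 1) ≤ massSchedule p n₀ n := by
  unfold massSchedule
  gcongr
  exact n.le_succ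

/-- For a Hölder probability density, the uncoupled part is eventually (in the parameter `n₀` of
the mass schedule) nonnegative with mass given by the schedule. -/
theorem eventually_remainder_spec {γs : ℕ → ℝ} (hmem : ∀ n, 1 ≤ n → γs n ∈ Ioo (0 : ℝ) 1)
    {γstar : ℝ} (hstar : γstar ∈ Ioo (0 : ℝ) 1) (hub : ∀ n, 1 ≤ n → γs n ≤ γstar)
    {γ : ℝ} (hγ : γ ∈ Ioo (0 : ℝ) 1) {c : ℝ} (hc : 0 < c) {N₁ : ℕ}
    (hcount : ∀ n, N₁ ≤ n → c * n ≤ (goodCount γs γ n : ℝ) - goodCount γs γ (n / 2 + 1))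
    {D r : ℝ} (hD : 0 ≤ D) (hr : 0 < r) (hr1 : r ≤ 1) {f : ℝ → ℝ} (hf0 : ∀ x, 0 ≤ f x)
    (hf : ∀ x ∈ Icc (0 : ℝ) 1, ∀ y ∈ Icc (0 : ℝ) 1, |f x - f y| ≤ D * |x - y| ^ r)
    (hfi : IntegrableOn f (Ioc 0 1)) (hf1 : ∫ x in Ioc 0 1, f x = 1) :
    ∀ᶠ n₀ : ℕ in atTop, ∀ n,
      (∀ x ∈ Ioc (0 : ℝ) 1, 0 ≤ remainder γs (massSchedule (1 / γ) n₀) f n x) ∧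
      IntegrableOn (remainder γs (massSchedule (1 / γ) n₀) f n) (Ioc 0 1) ∧
      ∫ x in Ioc 0 1, remainder γs (massSchedule (1 / γ) n₀) f n x =
        massSchedule (1 / γ) n₀ n := by
  have hF : ∀ x ∈ Ioc (0 : ℝ) 1, f x + 1 ≤ f 1 + D + 1 := by
    intro x hx
    have h1 := (le_abs_self _).trans (hf x ⟨hx.1.le, hx.2⟩ 1 (by simp))
    have h2 : |x - 1| ^ r ≤ 1 := by
      refine Real.rpow_le_one (abs_nonneg _) ?_ hr.le
      rw [abs_le]
      constructor <;> linarith [hx.1, hx.2]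
    have h3 := mul_le_mul_of_nonneg_left h2 hD
    linarith
  have hp : 1 < 1 / γ := (one_lt_div hγ.1).2 hγ.2
  obtain ⟨x₀, hx₀, htail⟩ := exists_pullback_sum_le (fun n hn => (hmem n hn).1) hstar hub hγ hc
    hcount (by linarith [hf0 1] : 0 ≤ f 1 + D + 1)
    (Real.exp_pos (logModulus D r (Real.log (1 / (1 / 2))))).le
  set η := (1 - (1 / 2) ^ r) * ((Real.exp (logModulus D r (Real.log (1 / x₀))))⁻¹ / 4) with hη_def
  have hη : 0 < η := by
    have : (1 / 2 : ℝ) ^ r < 1 := Real.rpow_lt_one (by norm_num) (by norm_num) hr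
    have := sub_pos.2 this
    positivity
  have hev : ∀ᶠ n₀ : ℕ in atTop, 1 / γ / (n₀ : ℝ) ≤ η :=
    ((tendsto_const_div_atTop_nhds_zero_nat (1 / γ)).eventually (gt_mem_nhds hη)).mono
      fun _ h => h.le
  filter_upwards [htail, hev, eventually_gt_atTop 0] with n₀ ht hn hn₀ n
  obtain ⟨h1, h2, h3, -⟩ := remainder_spec (M := massSchedule (1 / γ) n₀) hmem hD hr hr1 hfi hf1 hF
    (logRegular_add_one hD hr hf0 hf) (massSchedule_zero _ hn₀)
    (massSchedule_succ_le (by linarith) hn₀) hx₀ ht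
    (fun k => by
      rw [← mul_assoc, ← hη_def]
      exact (massSchedule_sub_le hp.le hn₀ k).trans
        (mul_le_mul_of_nonneg_right hn (massSchedule_pos _ hn₀ k).le)) n
  exact ⟨h1.1, h2, h3⟩

/-- A probability measure with Hölder density has a globally nonnegative continuous density. -/
theorem HolderDensityOn.exists_density {μ : Measure ℝ} [IsProbabilityMeasure μ]
    (h : HolderDensityOn (Icc 0 1) μ) :
    ∃ (f : ℝ → ℝ) (D r : ℝ), 0 ≤ D ∧ 0 < r ∧ r ≤ 1 ∧ (∀ x, 0 ≤ f x) ∧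
      (∀ x ∈ Icc (0 : ℝ) 1, ∀ y ∈ Icc (0 : ℝ) 1, |f x - f y| ≤ D * |x - y| ^ r) ∧
      IntegrableOn f (Ioc 0 1) ∧ (∫ x in Ioc 0 1, f x = 1) ∧
      ∀ S, MeasurableSet S → (μ S).toReal = ∫ x in Ioc 0 1 ∩ S, f x := by
  obtain ⟨f, hf0, ⟨C, r, hr, hr1, hH⟩, rfl⟩ := h
  have hcont : ContinuousOn f (Icc 0 1) := hH.continuousOn hr
  have hint : IntegrableOn f (Ioc 0 1) := hcont.integrableOn_Icc.mono_set Ioc_subset_Icc_self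
  have hμ : ∀ S, MeasurableSet S → (((volume.restrict (Icc (0 : ℝ) 1)).withDensity
      fun x => ENNReal.ofReal (f x)) S).toReal = ∫ x in Ioc 0 1 ∩ S, f x := by
    intro S hS
    rw [withDensity_apply _ hS, Measure.restrict_restrict hS, inter_comm,
      ← ofReal_integral_eq_lintegral_ofReal
        (hcont.integrableOn_Icc.mono_set inter_subset_left) (.of_forall hf0),
      ENNReal.toReal_ofReal (integral_nonneg hf0)]
    exact setIntegral_congr_set (Ioc_ae_eq_Icc.symm.inter (ae_eq_refl S))
  refine ⟨f, C, r, C.2, hr, hr1, hf0, fun x hx y hy => hH.dist_le hx hy, hint, ?_, hμ⟩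
  have h1 := hμ univ MeasurableSet.univ
  rw [measure_univ, inter_univ] at h1
  simpa using h1.symm

/-- If the proportion of good indices is asymptotically almost constant, then a positive proportion
of the indices in `(n / 2, n]` is good. -/
theorem goodCount_window {γs : ℕ → ℝ} {γ a κ : ℝ} (ha : 0 < a) (hκ : κ ≤ 1 / 4) {N : ℕ}
    (h : ∀ n : ℕ, N ≤ n → 1 ≤ n →
      (goodCount γs γ n : ℝ) / n ∈ Icc (a * (1 - κ)) (a * (1 + κ))) (n : ℕ)
    (hn : 2 * N + 20 ≤ n) :
    a / 16 * n ≤ (goodCount γs γ n : ℝ) - goodCount γs γ (n / 2 + 1) := by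
  have hn0 : (0 : ℝ) < n := by
    have : 0 < n := by omega
    positivity
  have hm0 : (0 : ℝ) < (n / 2 + 1 : ℕ) := by positivity
  have h1 := (le_div_iff₀ hn0).1 (h n (by omega) (by omega)).1
  have h2 := (div_le_iff₀ hm0).1 (h (n / 2 + 1) (by omega) (by omega)).2
  have h3 : ((n / 2 + 1 : ℕ) : ℝ) ≤ n / 2 + 1 := by
    push_cast
    linarith [(Nat.cast_div_le : ((n / 2 : ℕ) : ℝ) ≤ (n : ℝ) / (2 : ℕ))]
  have h4 : (20 : ℝ) ≤ n := by exact_mod_cast (show 20 ≤ n by omega)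
  have h5 : a * (3 / 4) * n ≤ a * (1 - κ) * n := by gcongr; linarith
  have h6 : a * (1 + κ) * (n / 2 + 1 : ℕ) ≤ a * (5 / 4) * (n / 2 + 1) := by
    have : 0 ≤ a * (5 / 4) := by positivity
    exact mul_le_mul (by gcongr; linarith) h3 hm0.le this
  have h7 := mul_le_mul_of_nonneg_left h4 ha.le
  linarith

theorem stmt1 (γs : ℕ → ℝ) (hmem : ∀ n, 1 ≤ n → γs n ∈ Ioo (0:ℝ) 1)
    (γstar : ℝ) (hstar : γstar < 1) (hub : ∀ n, 1 ≤ n → γs n ≤ γstar)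
    (γ : ℝ) (hγ : γ ∈ Ioo (0:ℝ) 1) :
    ∃ κ₀ ∈ Ioo (0:ℝ) 1,
      ∀ a : ℝ, 0 < a → ∀ κ : ℝ, 0 < κ → κ ≤ κ₀ → ∀ N : ℕ,
        (∀ n : ℕ, N ≤ n → 1 ≤ n →
          (((Finset.Icc 1 n).filter fun k => γs k ≤ γ).card : ℝ) / n ∈
            Icc (a * (1 - κ)) (a * (1 + κ))) →
        ∀ μ μ' : Measure ℝ, IsProbabilityMeasure μ → IsProbabilityMeasure μ' →
          HolderDensityOn (Icc (0:ℝ) 1) μ → HolderDensityOn (Icc (0:ℝ) 1) μ' →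
          ∃ C : ℝ, ∀ n : ℕ, 1 ≤ n →
            tvDist (Measure.map (seqComp (fun i => lsv (γs i)) 1 n) μ)
                (Measure.map (seqComp (fun i => lsv (γs i)) 1 n) μ') ≤
              C * (n : ℝ) ^ (-1 / γ) := by
  refine ⟨1 / 4, by norm_num, fun a ha κ _ hκ N hfreq μ μ' _ _ hμ hμ' => ?_⟩
  obtain ⟨f, D, r, hD, hr, hr1, hf0, hfH, hfi, hf1, hfμ⟩ := hμ.exists_density
  obtain ⟨g, D', r', hD', hr', hr1', hg0, hgH, hgi, hg1, hgμ⟩ := hμ'.exists_density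
  have hcount := goodCount_window (γs := γs) (γ := γ) ha hκ hfreq
  have hst : γstar ∈ Ioo (0 : ℝ) 1 := ⟨(hmem 1 le_rfl).1.trans_le (hub 1 le_rfl), hstar⟩
  have ha' : 0 < a / 16 := by positivity
  obtain ⟨n₀, hF, hG, hn₀⟩ :=
    ((eventually_remainder_spec hmem hst hub hγ ha' hcount hD hr hr1 hf0 hfH hfi hf1).and
      ((eventually_remainder_spec hmem hst hub hγ ha' hcount hD' hr' hr1' hg0 hgH hgi hg1).and
        (eventually_gt_atTop 0))).exists
  set M := massSchedule (1 / γ) n₀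
  have hmeas := measurable_seqComp (fun i => measurable_lsv (γs i)) 1
  have key := setIntegral_seqComp (γs := γs) (fun n hn => (hmem n hn).1)
    (f := fun n x => remainder γs M f n x - remainder γs M g n x)
    (fun n => (hF n).2.1.sub (hG n).2.1) (fun n x _ => by
      rw [lsvTransfer_sub, add_comm 1 n]
      simp only [remainder]
      ring)
  refine ⟨2 * (n₀ : ℝ) ^ (1 / γ), fun n hn => ciSup_le ?_⟩
  rintro ⟨S, hS⟩
  rw [Measure.map_apply (hmeas n) hS, Measure.map_apply (hmeas n) hS, hfμ _ (hmeas n hS),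
    hgμ _ (hmeas n hS), ← integral_sub (hfi.mono_set inter_subset_left)
      (hgi.mono_set inter_subset_left)]
  have h1 := key n hS
  simp only [remainder, add_sub_add_right_eq_sub] at h1
  have hbound : ∀ R : ℝ → ℝ, (∀ x ∈ Ioc (0 : ℝ) 1, 0 ≤ R x) → IntegrableOn R (Ioc 0 1) →
      0 ≤ ∫ x in Ioc 0 1 ∩ S, R x ∧ ∫ x in Ioc 0 1 ∩ S, R x ≤ ∫ x in Ioc 0 1, R x := by
    intro R hR hRi
    refine ⟨setIntegral_nonneg (measurableSet_Ioc.inter hS) fun x hx => hR x hx.1,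
      setIntegral_mono_set hRi ?_ inter_subset_left.eventuallyLE⟩
    exact (ae_restrict_iff' measurableSet_Ioc).2 (.of_forall fun t ht => hR t ht)
  have h2 := hbound _ (hF n).1 (hF n).2.1
  have h3 := hbound _ (hG n).1 (hG n).2.1
  rw [(hF n).2.2] at h2
  rw [(hG n).2.2] at h3
  have hM : M n ≤ 2 * (n₀ : ℝ) ^ (1 / γ) * (n : ℝ) ^ (-1 / γ) := by
    rw [neg_div]
    exact massSchedule_le (one_div_pos.2 hγ.1) hn
  rw [h1, integral_sub ((hF n).2.1.mono_set inter_subset_left)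
    ((hG n).2.1.mono_set inter_subset_left), abs_le]
  constructor <;> linarith [h2.1, h2.2, h3.1, h3.2]

end
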